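/- Let A be a finite set, β > 0, R ≥ 0, r*: A → [0,R], π_ref a full-support pmf, and π* the Gibbs policy π*(a) ∝ π_ref(a)exp(r*(a)/β). Let π be any full-support pmf, let π̄ be any pmf, and suppose the preference model satisfies P(y=1|a,a') ≥ 1/2 whenever r*(a) ≥ r*(a'). Then for all γ > 0, Cov(π*|π) := Σ_a π*(a)²/π(a) ≥ 1/(√((γ + 2P(π̄ ≻ π))log((1+γ)/γ)) + √(KL(π̄‖π*)/2)). -/

import Mathlib

/-- Gibbs variational inequality: `E_m log (g/m) ≤ log Σ g`. -/
lemma gibbs_aux {A : Type*} [Fintype A] (m g : A → ℝ) (hm : ∀ a, 0 ≤ m a)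
    (hs : ∑ a, m a = 1) (hg : ∀ a, 0 ≤ g a) (hg' : ∀ a, 0 < m a → 0 < g a) (G : ℝ)
    (hG : ∑ a, g a ≤ G) (hG0 : 0 < G) :
    ∑ a, m a * Real.log (g a / m a) ≤ Real.log G := by
  have h1 : ∀ a, m a * Real.log (g a / m a) ≤ g a / G - m a + m a * Real.log G := by
    intro a
    rcases (hm a).eq_or_lt with h | h
    · rw [← h]
      have := div_nonneg (hg a) hG0.le
      simpa using this
    · have hga := hg' a h
      have h2 := Real.log_le_sub_one_of_pos (x := g a / m a / G) (by positivity)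
      rw [Real.log_div (by positivity) hG0.ne'] at h2
      have h3 : m a * (g a / m a / G) = g a / G := by field_simp
      nlinarith [mul_le_mul_of_nonneg_left h2 h.le]
  calc _ ≤ ∑ a, (g a / G - m a + m a * Real.log G) := Finset.sum_le_sum fun a _ => h1 a
    _ = (∑ a, g a) / G - 1 + Real.log G := by
      rw [Finset.sum_add_distrib, Finset.sum_sub_distrib, ← Finset.sum_mul, hs,
        Finset.sum_div, one_mul]
    _ ≤ _ := by
      have : (∑ a, g a) / G ≤ 1 := by rw [div_le_one hG0]; exact hG
      linarith

lemma exp_aux (T : ℝ) (hT : 0 ≤ T) : 1 ≤ Real.exp (-(2 * T ^ 2)) + T := by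
  rcases le_total 1 T with h | h
  · linarith [Real.exp_pos (-(2 * T ^ 2))]
  rcases le_total T (1 / 2) with h2 | h2
  · nlinarith [Real.add_one_le_exp (-(2 * T ^ 2))]
  · have e1 : Real.exp (-(9 / 8)) ≥ 8 / 25 := by
      have h3 : Real.exp (-(9 / 8)) = Real.exp (-1) * Real.exp (-(1 / 8)) := by
        rw [← Real.exp_add]; norm_num
      have h4 := Real.add_one_le_exp (-(1 / 8) : ℝ)
      have h5 := Real.exp_neg_one_gt_d9
      rw [h3]
      nlinarith
    have e2 : Real.exp (-(2 * T ^ 2)) = Real.exp (-(9 / 8)) * Real.exp (9 / 8 - 2 * T ^ 2) := by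
      rw [← Real.exp_add]; ring_nf
    have e3 := Real.add_one_le_exp (9 / 8 - 2 * T ^ 2)
    have e4 : 0 ≤ 9 / 8 - 2 * T ^ 2 + 1 := by nlinarith
    have e5 : 8 / 25 * (9 / 8 - 2 * T ^ 2 + 1) ≤ Real.exp (-(2 * T ^ 2)) := by
      rw [e2]
      exact mul_le_mul e1 e3 e4 (Real.exp_pos _).le
    nlinarith

open Classical in
lemma cum_aux {A : Type*} (q r : A → ℝ) (hq : ∀ a, 0 < q a) (γ : ℝ) (hγ : 0 < γ)
    (s : Finset A) :
    ∑ a ∈ s, q a / (γ + ∑ b ∈ s, if r b ≤ r a then q b else 0) ≤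
      Real.log ((γ + ∑ a ∈ s, q a) / γ) := by
  induction s using Finset.induction_on_max_value r with
  | empty => simp [hγ.ne']
  | insert a s ha hmax ih =>
    have hQ : 0 ≤ ∑ b ∈ s, q b := Finset.sum_nonneg fun b _ => (hq b).le
    have hqa := hq a
    have hnn : ∀ x, 0 ≤ ∑ b ∈ s, if r b ≤ r x then q b else 0 := fun x =>
      Finset.sum_nonneg fun b _ => by split_ifs; exacts [(hq b).le, le_rfl]
    rw [Finset.sum_insert ha]
    have h1 : (∑ b ∈ insert a s, if r b ≤ r a then q b else 0) = q a + ∑ b ∈ s, q b := by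
      rw [Finset.sum_insert ha, if_pos le_rfl]
      congr 1
      exact Finset.sum_congr rfl fun b hb => if_pos (hmax b hb)
    have h2 : ∑ x ∈ s, q x / (γ + ∑ b ∈ insert a s, if r b ≤ r x then q b else 0) ≤
        ∑ x ∈ s, q x / (γ + ∑ b ∈ s, if r b ≤ r x then q b else 0) := by
      refine Finset.sum_le_sum fun x _ => ?_
      have h0 := hnn x
      rw [Finset.sum_insert ha]
      apply div_le_div_of_nonneg_left (hq x).le (by linarith)
      split_ifs <;> linarith
    rw [h1, Finset.sum_insert ha]
    set Q := ∑ b ∈ s, q b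
    have h3 := Real.one_sub_inv_le_log_of_pos (x := (γ + (q a + Q)) / (γ + Q)) (by positivity)
    have h4 : 1 - ((γ + (q a + Q)) / (γ + Q))⁻¹ = q a / (γ + (q a + Q)) := by
      field_simp; ring
    have h5 : Real.log ((γ + (q a + Q)) / γ) =
        Real.log ((γ + (q a + Q)) / (γ + Q)) + Real.log ((γ + Q) / γ) := by
      rw [← Real.log_mul (by positivity) (by positivity)]
      congr 1; field_simp
    linarith


theorem coverage_lower_bound_winrate
    {A : Type*} [Fintype A] [Nonempty A]
    (β R : ℝ) (hβ : 0 < β) (hR : 0 ≤ R)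
    (πref πstar π πbar : A → ℝ) (rstar : A → ℝ) (P : A → A → ℝ)
    (href_pos : ∀ a, 0 < πref a) (href_sum : ∑ a, πref a = 1)
    (hr : ∀ a, rstar a ∈ Set.Icc 0 R)
    (Z : ℝ) (hZ : Z = ∑ a, πref a * Real.exp (rstar a / β))
    (hgibbs : ∀ a, πstar a = πref a * Real.exp (rstar a / β) / Z)
    (hπ_pos : ∀ a, 0 < π a) (hπ_sum : ∑ a, π a = 1)
    (hbar_nonneg : ∀ a, 0 ≤ πbar a) (hbar_sum : ∑ a, πbar a = 1)
    (hP_mem : ∀ a a', P a a' ∈ Set.Icc (0 : ℝ) 1)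
    (hP_half : ∀ a a', rstar a' ≤ rstar a → (1 : ℝ) / 2 ≤ P a a') :
    ∀ γ : ℝ, 0 < γ →
      1 / (Real.sqrt ((γ + 2 * ∑ a, ∑ a', πbar a * π a' * P a a') *
              Real.log ((1 + γ) / γ)) +
            Real.sqrt ((∑ a, πbar a * Real.log (πbar a / πstar a)) / 2)) ≤
        ∑ a, (πstar a) ^ 2 / π a :=
 by
  classical
  intro γ hγ
  have hZ0 : 0 < Z := by
    rw [hZ]
    exact Finset.sum_pos (fun a _ => mul_pos (href_pos a) (Real.exp_pos _))
      Finset.univ_nonempty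
  have hp : ∀ a, 0 < πstar a := fun a => by
    rw [hgibbs]
    exact div_pos (mul_pos (href_pos a) (Real.exp_pos _)) hZ0
  have hps : ∑ a, πstar a = 1 := by
    simp only [hgibbs]
    rw [← Finset.sum_div, ← hZ, div_self hZ0.ne']
  set C := ∑ a, (πstar a) ^ 2 / π a with hC
  set K := ∑ a, πbar a * Real.log (πbar a / πstar a) with hK
  set W := ∑ a, ∑ a', πbar a * π a' * P a a' with hW
  set L := Real.log ((1 + γ) / γ) with hL
  have hC1 : 1 ≤ C := by
    have : ∑ a, (2 * πstar a - π a) ≤ C := by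
      refine Finset.sum_le_sum fun a _ => ?_
      rw [le_div_iff₀ (hπ_pos a)]
      nlinarith [sq_nonneg (πstar a - π a)]
    rw [Finset.sum_sub_distrib, ← Finset.mul_sum, hps, hπ_sum] at this
    linarith
  have hL0 : 0 < L := Real.log_pos (by rw [lt_div_iff₀ hγ]; linarith)
  let F : A → ℝ := fun a => ∑ b, if rstar b ≤ rstar a then π b else 0
  have hF : ∀ a, 0 ≤ F a := fun a =>
    Finset.sum_nonneg fun b _ => by split_ifs; exacts [(hπ_pos b).le, le_rfl]
  have hsum : ∑ a, π a / (γ + F a) ≤ L := by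
    have := cum_aux π rstar hπ_pos γ hγ Finset.univ
    rw [hπ_sum, add_comm γ 1] at this
    exact this
  have hWF : ∑ a, πbar a * F a ≤ 2 * W := by
    rw [hW, Finset.mul_sum]
    refine Finset.sum_le_sum fun a _ => ?_
    rw [Finset.mul_sum, Finset.mul_sum]
    refine Finset.sum_le_sum fun b _ => ?_
    have hmq := mul_nonneg (hbar_nonneg a) (hπ_pos b).le
    split_ifs with h
    · nlinarith [hP_half a b h]
    · nlinarith [mul_nonneg hmq (hP_mem a b).1]
  have hmF : 0 ≤ ∑ a, πbar a * F a :=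
    Finset.sum_nonneg fun a _ => mul_nonneg (hbar_nonneg a) (hF a)
  have hW0 : 0 < γ + 2 * W := by linarith
  have hgF : ∀ a, 0 < γ + F a := fun a => by linarith [hF a]
  have g1 := gibbs_aux πbar (fun a => π a / (γ + F a)) hbar_nonneg hbar_sum
    (fun a => (div_pos (hπ_pos a) (hgF a)).le) (fun a _ => div_pos (hπ_pos a) (hgF a)) L hsum hL0
  have g2 := gibbs_aux πbar (fun a => πbar a * (γ + F a)) hbar_nonneg hbar_sum
    (fun a => mul_nonneg (hbar_nonneg a) (hgF a).le) (fun a h => mul_pos h (hgF a))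
    (γ + 2 * W) (by
      simp only [mul_add]
      rw [Finset.sum_add_distrib, ← Finset.sum_mul, hbar_sum]; linarith) hW0
  have g3 := gibbs_aux πbar (fun a => πstar a ^ 2 / π a) hbar_nonneg hbar_sum
    (fun a => (div_pos (pow_pos (hp a) 2) (hπ_pos a)).le)
    (fun a _ => div_pos (pow_pos (hp a) 2) (hπ_pos a)) C le_rfl (by linarith)
  have g4 := gibbs_aux πbar πstar hbar_nonneg hbar_sum (fun a => (hp a).le)
    (fun a _ => hp a) 1 hps.le one_pos
  have hKneg : ∑ a, πbar a * Real.log (πstar a / πbar a) = -K := by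
    rw [hK, ← Finset.sum_neg_distrib]
    refine Finset.sum_congr rfl fun a _ => ?_
    rw [← inv_div, Real.log_inv]; ring
  have hK0 : 0 ≤ K := by
    rw [hKneg, Real.log_one] at g4; linarith
  have hkey : -(2 * K) ≤ Real.log ((γ + 2 * W) * L * C) := by
    rw [Real.log_mul (by positivity) (by positivity), Real.log_mul hW0.ne' hL0.ne']
    have : -(2 * K) = ∑ a, πbar a * Real.log (π a / (γ + F a) / πbar a) +
        ∑ a, πbar a * Real.log (πbar a * (γ + F a) / πbar a) +
        ∑ a, πbar a * Real.log (πstar a ^ 2 / π a / πbar a) := by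
      rw [hK, Finset.mul_sum, ← Finset.sum_neg_distrib, ← Finset.sum_add_distrib,
        ← Finset.sum_add_distrib]
      refine Finset.sum_congr rfl fun a _ => ?_
      rcases (hbar_nonneg a).eq_or_lt with h | h
      · simp [← h]
      · have n1 := (hπ_pos a).ne'
        have n2 := (hgF a).ne'
        have n3 := (hp a).ne'
        have n4 := h.ne'
        rw [mul_div_cancel_left₀ _ n4, Real.log_div (div_ne_zero n1 n2) n4,
          Real.log_div n1 n2, Real.log_div (div_ne_zero (pow_ne_zero 2 n3) n1) n4,
          Real.log_div (pow_ne_zero 2 n3) n1, Real.log_div n4 n3, Real.log_pow]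
        push_cast
        ring
    linarith
  have hS : 0 < (γ + 2 * W) * L := mul_pos hW0 hL0
  have hC0 : 0 < C := by linarith
  have hexp : Real.exp (-(2 * K)) ≤ (γ + 2 * W) * L * C :=
    (Real.le_log_iff_exp_le (mul_pos hS hC0)).1 hkey
  set B := Real.sqrt ((γ + 2 * W) * L) with hB
  set T := Real.sqrt (K / 2) with hT
  have hB0 : 0 < B := Real.sqrt_pos.2 hS
  have hT0 : 0 ≤ T := Real.sqrt_nonneg _
  have hB2 : B ^ 2 = (γ + 2 * W) * L := Real.sq_sqrt hS.le
  have hT2 : T ^ 2 = K / 2 := Real.sq_sqrt (by linarith)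
  have hBC : Real.exp (-K) ≤ B * C := by
    refine (sq_le_sq₀ (Real.exp_pos _).le (by positivity)).1 ?_
    have : Real.exp (-K) ^ 2 = Real.exp (-(2 * K)) := by
      rw [← Real.exp_nat_mul]; congr 1; push_cast; ring
    rw [this, mul_pow, hB2]
    nlinarith [mul_nonneg (mul_nonneg hS.le hC0.le) (sub_nonneg.2 hC1)]
  have hfin := exp_aux T hT0
  rw [hT2, show -(2 * (K / 2)) = -K by ring] at hfin
  rw [div_le_iff₀ (by linarith)]
  nlinarith [mul_nonneg hT0 (sub_nonneg.2 hC1)]
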